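/- arXiv:2307.07276 — 2 statements merged into one kernel-verified Lean document; each statement's English description precedes it below -/
import Mathlib

section
/- Let (W,S) be a Coxeter system and let l = (s_1, …, s_k) be a word in S. Then l is the unique reduced expression of its product in W if and only if both of the following hold: (1) s_i ≠ s_{i+1} for all 1 ≤ i < k; and (2) for every pair of distinct generators s,t ∈ S with m(s,t) finite, l contains no contiguous subword equal to the alternating word (s,t,s,t,…) of length m(s,t). -/
/-- The alternating word `(s, t, s, t, …)` of length `k`, starting with `s`. -/
def altWord {B : Type*} (s t : B) : ℕ → List B
  | 0 => []
  | k + 1 => s :: altWord t s k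

section Geometric
open Module

variable {V : Type*} [AddCommGroup V] [Module ℝ V] {a b : V} {f g : Dual ℝ V}

/-- The product of two reflections applied to a combination of their roots. -/
theorem preReflection_mul_preReflection_apply_comb {c : ℝ} (ha : f a = 2) (hb : g b = 2)
    (hab : f b = -2 * c) (hba : g a = -2 * c) (x y : ℝ) :
    (preReflection a f * preReflection b g : End ℝ V) (x • a + y • b) =
      (2 * c * (2 * c * x - y) - x) • a + (2 * c * x - y) • b := by
  simp only [End.mul_apply, preReflection_apply, map_add, map_smul, map_sub, ha, hb, hab, hba]
  module

theorem sin_smul_preReflection_mul_preReflection_pow_apply {θ : ℝ} (ha : f a = 2) (hb : g b = 2)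
    (hab : f b = -2 * Real.cos θ) (hba : g a = -2 * Real.cos θ) (k : ℕ) :
    Real.sin θ • ((preReflection a f * preReflection b g : End ℝ V) ^ k) a =
      Real.sin ((2 * k + 1) * θ) • a + Real.sin (2 * k * θ) • b := by
  induction k with
  | zero => simp
  | succ k ih =>
    have key (x : ℝ) : Real.sin (x + θ) = 2 * Real.cos θ * Real.sin x - Real.sin (x - θ) := by
      rw [Real.sin_add, Real.sin_sub]; ring
    have h₁ := key ((2 * k + 1) * θ)
    have h₂ := key ((2 * k + 2) * θ)
    rw [pow_succ', End.mul_apply, ← map_smul, ih,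
      preReflection_mul_preReflection_apply_comb ha hb hab hba]
    push_cast
    ring_nf at h₁ h₂ ⊢
    rw [h₂, h₁]
    ring_nf

theorem preReflection_mul_preReflection_pow_apply_of_parabolic (ha : f a = 2) (hb : g b = 2)
    (hab : f b = -2) (hba : g a = -2) (k : ℕ) :
    ((preReflection a f * preReflection b g : End ℝ V) ^ k) a =
      (2 * k + 1 : ℝ) • a + (2 * k : ℝ) • b := by
  induction k with
  | zero => simp
  | succ k ih =>
    rw [pow_succ', End.mul_apply, ih,
      preReflection_mul_preReflection_apply_comb (c := 1) ha hb (by simpa) (by simpa)]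
    push_cast
    ring_nf

theorem preReflection_mul_preReflection_pow_apply_left {m : ℕ} (hm : 2 ≤ m)
    (ha : f a = 2) (hb : g b = 2)
    (hab : f b = -2 * Real.cos (Real.pi / m)) (hba : g a = -2 * Real.cos (Real.pi / m)) :
    ((preReflection a f * preReflection b g : End ℝ V) ^ m) a = a := by
  have hm0 : (m : ℝ) ≠ 0 := by positivity
  have h2 : (2 : ℝ) ≤ m := by exact_mod_cast hm
  have hsin : Real.sin (Real.pi / m) ≠ 0 :=
    (Real.sin_pos_of_pos_of_lt_pi (by positivity)
      (div_lt_self Real.pi_pos (by linarith))).ne'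
  have h := sin_smul_preReflection_mul_preReflection_pow_apply ha hb hab hba m
  rw [show (2 * m + 1) * (Real.pi / m) = Real.pi / m + 2 * Real.pi by field_simp; ring,
    show 2 * m * (Real.pi / m) = 2 * Real.pi by field_simp, Real.sin_add_two_pi,
    Real.sin_two_pi, zero_smul, add_zero] at h
  exact smul_right_injective V hsin h

theorem preReflection_mul_preReflection_pow_eq_one {m : ℕ} (hm : 2 ≤ m)
    (ha : f a = 2) (hb : g b = 2)
    (hab : f b = -2 * Real.cos (Real.pi / m)) (hba : g a = -2 * Real.cos (Real.pi / m)) :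
    (preReflection a f * preReflection b g : End ℝ V) ^ m = 1 := by
  have h2 : (2 : ℝ) ≤ m := by exact_mod_cast hm
  have hsin : 0 < Real.sin (Real.pi / m) :=
    Real.sin_pos_of_pos_of_lt_pi (by positivity) (div_lt_self Real.pi_pos (by linarith))
  have hfa := preReflection_mul_preReflection_pow_apply_left hm ha hb hab hba
  have hgb := preReflection_mul_preReflection_pow_apply_left hm hb ha hba hab
  have hf1 : preReflection a f * preReflection a f = (1 : End ℝ V) :=
    LinearMap.ext (involutive_preReflection ha)
  have hg1 : preReflection b g * preReflection b g = (1 : End ℝ V) :=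
    LinearMap.ext (involutive_preReflection hb)
  have hinv : (preReflection a f * preReflection b g : End ℝ V) *
      (preReflection b g * preReflection a f) = 1 := by
    rw [mul_assoc, ← mul_assoc (preReflection b g), hg1, one_mul, hf1]
  have hinv' : (preReflection b g * preReflection a f : End ℝ V) *
      (preReflection a f * preReflection b g) = 1 := by
    rw [mul_assoc, ← mul_assoc (preReflection a f), hf1, one_mul, hg1]
  have hfb : ((preReflection a f * preReflection b g : End ℝ V) ^ m) b = b := by
    have hc : Commute (preReflection a f * preReflection b g : End ℝ V)
      (preReflection b g * preReflection a f) := hinv.trans hinv'.symm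
    calc _ = ((preReflection a f * preReflection b g : End ℝ V) ^ m)
          (((preReflection b g * preReflection a f : End ℝ V) ^ m) b) := by rw [hgb]
      _ = b := by rw [← End.mul_apply, ← hc.mul_pow, hinv, one_pow, End.one_apply]
  have horth (v : V) (hf : f v = 0) (hg : g v = 0) :
      ((preReflection a f * preReflection b g : End ℝ V) ^ m) v = v := by
    have hv : (preReflection a f * preReflection b g : End ℝ V) v = v := by
      simp [preReflection_apply, hf, hg]
    rw [End.pow_apply]
    exact Function.iterate_fixed hv m
  ext v
  set c := Real.cos (Real.pi / m) with hc
  have hdet : 1 - c ^ 2 ≠ 0 := by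
    have := Real.sin_sq_add_cos_sq (Real.pi / m)
    rw [← hc] at this
    have : 0 < Real.sin (Real.pi / m) ^ 2 := by positivity
    linarith
  set x := (f v + c * g v) / (2 * (1 - c ^ 2)) with hx
  set y := (g v + c * f v) / (2 * (1 - c ^ 2)) with hy
  have hdec : v = (v - x • a - y • b) + x • a + y • b := by module
  conv_lhs => rw [hdec]
  rw [map_add, map_add, map_smul, map_smul, hfa, hfb, horth]
  · exact hdec.symm
  · simp only [map_sub, map_smul, ha, hab, smul_eq_mul, hx, hy]
    field_simp
    ring
  · simp only [map_sub, map_smul, hb, hba, smul_eq_mul, hx, hy]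
    field_simp
    ring

theorem dvd_of_preReflection_mul_preReflection_pow_eq_one {m : ℕ} (hm : m ≠ 1)
    (ha : f a = 2) (hb : g b = 2) (hlin : LinearIndependent ℝ ![a, b])
    (hab : f b = -2 * Real.cos (Real.pi / m)) (hba : g a = -2 * Real.cos (Real.pi / m)) {k : ℕ}
    (hk : (preReflection a f * preReflection b g : End ℝ V) ^ k = 1) : m ∣ k := by
  rw [LinearIndependent.pair_iff] at hlin
  rcases Nat.eq_zero_or_pos m with rfl | hm0
  · have h := preReflection_mul_preReflection_pow_apply_of_parabolic ha hb (by simpa using hab)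
      (by simpa using hba) k
    rw [hk, End.one_apply] at h
    have h2 := (hlin (2 * k) (2 * k) (by
      rw [add_smul, one_smul, add_right_comm] at h
      exact right_eq_add.mp h)).1
    simp at h2
    simp [h2]
  · have h2 : (2 : ℝ) ≤ m := by exact_mod_cast (show 2 ≤ m by lia)
    have hsin : 0 < Real.sin (Real.pi / m) :=
      Real.sin_pos_of_pos_of_lt_pi (by positivity) (div_lt_self Real.pi_pos (by linarith))
    have h := sin_smul_preReflection_mul_preReflection_pow_apply ha hb hab hba k
    rw [hk, End.one_apply] at h
    obtain ⟨h₁, h₂⟩ := hlin (Real.sin ((2 * k + 1) * (Real.pi / m)) - Real.sin (Real.pi / m))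
      (Real.sin (2 * k * (Real.pi / m))) (by rw [sub_smul, h]; module)
    rw [add_mul, one_mul, Real.sin_add, h₂] at h₁
    have hcos : Real.cos (2 * k * (Real.pi / m)) = 1 := by
      have : (Real.cos (2 * k * (Real.pi / m)) - 1) * Real.sin (Real.pi / m) = 0 := by linarith
      rcases mul_eq_zero.mp this with h | h
      · linarith
      · exact absurd h hsin.ne'
    obtain ⟨n, hn⟩ := (Real.cos_eq_one_iff _).mp hcos
    have hnk : (n : ℝ) * m = k := by
      field_simp at hn
      linarith
    have hnk' : n * (m : ℤ) = k := by exact_mod_cast hnk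
    exact Int.natCast_dvd_natCast.mp ⟨n, by rw [← hnk', mul_comm]⟩

end Geometric

section OrderOf

namespace CoxeterMatrix

variable {B : Type*} (M : CoxeterMatrix B)

/-- The coroots of the geometric representation, whose simple roots are the vectors
`Finsupp.single i 1`. -/
noncomputable def coroot (i : B) : Module.Dual ℝ (B →₀ ℝ) :=
  Finsupp.linearCombination ℝ fun j ↦ -2 * Real.cos (Real.pi / M i j)

/-- The reflections of the geometric representation. -/
noncomputable def geomReflection (i : B) : Module.End ℝ (B →₀ ℝ) :=
  Module.preReflection (Finsupp.single i 1) (M.coroot i)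

theorem coroot_single (i j : B) :
    M.coroot i (Finsupp.single j 1) = -2 * Real.cos (Real.pi / M i j) := by
  simp [coroot]

theorem coroot_single_self (i : B) : M.coroot i (Finsupp.single i 1) = 2 := by
  simp [coroot]

theorem isLiftable_geomReflection : M.IsLiftable M.geomReflection := by
  intro i j
  rcases eq_or_ne i j with rfl | hij
  · rw [M.diagonal, pow_one]
    refine LinearMap.ext fun v ↦ ?_
    exact Module.involutive_preReflection (M.coroot_single_self i) v
  · rcases Nat.eq_zero_or_pos (M i j) with h0 | hpos
    · rw [h0, pow_zero]
    · have h1 := M.off_diagonal i j hij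
      refine preReflection_mul_preReflection_pow_eq_one (by lia) (M.coroot_single_self i)
        (M.coroot_single_self j) (M.coroot_single i j) ?_
      rw [M.coroot_single, M.symmetric]

end CoxeterMatrix

/-- The order of `s i * s j` is divisible by `M i j`. -/
theorem CoxeterSystem.dvd_of_simple_mul_simple_pow_eq_one {B W : Type*} [Group W]
    {M : CoxeterMatrix B} (cs : CoxeterSystem M W) {i j : B} (hij : i ≠ j) {k : ℕ}
    (hk : (cs.simple i * cs.simple j) ^ k = 1) : M i j ∣ k := by
  have h := congrArg (cs.lift ⟨_, M.isLiftable_geomReflection⟩) hk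
  rw [map_pow, map_mul, cs.lift_apply_simple, cs.lift_apply_simple, map_one] at h
  refine dvd_of_preReflection_mul_preReflection_pow_eq_one (M.off_diagonal i j hij)
    (M.coroot_single_self i) (M.coroot_single_self j) ?_ (M.coroot_single i j) ?_ h
  · rw [LinearIndependent.pair_iff]
    intro x y hxy
    have hi := DFunLike.congr_fun hxy i
    have hj := DFunLike.congr_fun hxy j
    simp [hij, hij.symm] at hi hj
    exact ⟨hi, hj⟩
  · rw [M.coroot_single, M.symmetric]

end OrderOf

section Exchange

namespace CoxeterSystem

open List

variable {B W : Type*} [Group W] {M : CoxeterMatrix B} (cs : CoxeterSystem M W)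

theorem prod_map_alternatingWord_two_mul {G : Type*} [Monoid G] (f : B → G) (i j : B) (m : ℕ) :
    ((alternatingWord i j (2 * m)).map f).prod = (f i * f j) ^ m := by
  induction m with
  | zero => simp [alternatingWord]
  | succ m ih =>
    rw [show 2 * (m + 1) = 2 * m + 1 + 1 by ring, alternatingWord_succ, alternatingWord_succ]
    simp [ih, pow_succ]

theorem reverse_alternatingWord_two_mul (i j : B) (m : ℕ) :
    (alternatingWord i j (2 * m)).reverse = alternatingWord j i (2 * m) := by
  refine ext_getElem (by simp) fun k h₁ h₂ ↦ ?_
  simp only [length_alternatingWord] at h₂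
  rw [getElem_reverse, getElem_alternatingWord _ _ _ _ (by simp; lia),
    getElem_alternatingWord _ _ _ _ h₂, length_alternatingWord]
  grind

open Classical in
/-- Every reflection occurs an even number of times in the inversion sequence of the word
`(i, j, i, j, …)` of length `2 * M i j`. -/
theorem count_rightInvSeq_alternatingWord (i j : B) (t : W) :
    ((cs.rightInvSeq (alternatingWord i j (2 * M i j))).count t : ZMod 2) = 0 := by
  have hlis : cs.leftInvSeq (alternatingWord j i (2 * M i j)) =
      (range (M i j + M i j)).map fun k ↦ cs.wordProd (alternatingWord i j (2 * k + 1)) := by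
    refine ext_getElem (by simp; lia) fun k h₁ h₂ ↦ ?_
    rw [cs.getElem_leftInvSeq_alternatingWord _ _ _ _ (by simpa using h₁)]
    simp
  have hperiod (k : ℕ) : cs.wordProd (alternatingWord i j (2 * (M i j + k) + 1)) =
      cs.wordProd (alternatingWord i j (2 * k + 1)) := by
    have hdiv (n : ℕ) : (2 * n + 1) / 2 = n := by lia
    simp [prod_alternatingWord_eq_mul_pow, hdiv, pow_add]
  rw [← reverse_alternatingWord_two_mul, rightInvSeq_reverse, hlis, count_reverse, range_add,
    map_append, map_map, count_append]
  simp only [Function.comp_def, hperiod]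
  rw [Nat.cast_add, CharTwo.add_self_eq_zero]

open Classical in
/-- The action of a simple reflection on pairs of a reflection and a sign. -/
noncomputable def signedReflectionAct (i : B) : Function.End (W × ZMod 2) := fun p ↦
  (cs.simple i * p.1 * cs.simple i, p.2 + if p.1 = cs.simple i then 1 else 0)

open Classical in
theorem prod_map_signedReflectionAct (ω : List B) (p : W × ZMod 2) :
    (ω.map cs.signedReflectionAct).prod p =
      (cs.wordProd ω * p.1 * (cs.wordProd ω)⁻¹, p.2 + ((cs.rightInvSeq ω).count p.1 : ZMod 2)) := by
  induction ω with
  | nil => simp [Function.End.one_def]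
  | cons i ω ih =>
    rw [map_cons, prod_cons]
    change cs.signedReflectionAct i ((ω.map cs.signedReflectionAct).prod p) = _
    have hiff : cs.wordProd ω * p.1 * (cs.wordProd ω)⁻¹ = cs.simple i ↔
        (cs.wordProd ω)⁻¹ * cs.simple i * cs.wordProd ω = p.1 := by
      constructor <;> intro h
      · rw [← h]; group
      · rw [← h]; group
    rw [ih, signedReflectionAct, rightInvSeq, count_cons, wordProd_cons]
    simp only [hiff, beq_iff_eq, Prod.mk.injEq]
    refine ⟨by simp [mul_assoc], ?_⟩
    push_cast
    ring

theorem isLiftable_signedReflectionAct : M.IsLiftable cs.signedReflectionAct := by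
  classical
  intro i j
  funext p
  rw [← prod_map_alternatingWord_two_mul, prod_map_signedReflectionAct,
    count_rightInvSeq_alternatingWord, prod_alternatingWord_eq_mul_pow]
  simp [Function.End.one_def]

open Classical in
/-- The parity of the number of occurrences of `t` in the inversion sequence of a word depends only
on the product of the word. -/
theorem count_rightInvSeq_eq_of_wordProd_eq {ω ω' : List B}
    (h : cs.wordProd ω = cs.wordProd ω') (t : W) :
    ((cs.rightInvSeq ω).count t : ZMod 2) = (cs.rightInvSeq ω').count t := by
  have hlift (ν : List B) : cs.lift ⟨_, cs.isLiftable_signedReflectionAct⟩ (cs.wordProd ν) =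
      (ν.map cs.signedReflectionAct).prod := by
    rw [wordProd, map_list_prod, map_map]
    congr 2
    funext i
    exact cs.lift_apply_simple _ i
  have := congrFun ((hlift ω).symm.trans ((congrArg _ h).trans (hlift ω'))) (t, 0)
  rw [prod_map_signedReflectionAct, prod_map_signedReflectionAct] at this
  simpa using congrArg Prod.snd this

theorem simple_mem_rightInvSeq_of_isRightDescent {ω : List B} {i : B}
    (h : cs.IsRightDescent (cs.wordProd ω) i) : cs.simple i ∈ cs.rightInvSeq ω := by
  classical
  obtain ⟨ν, hν, hνω⟩ := cs.exists_isReduced (cs.wordProd ω * cs.simple i)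
  have hprod : cs.wordProd (ν.concat i) = cs.wordProd ω := by
    rw [wordProd_concat, ← hνω, simple_mul_simple_cancel_right]
  have hred : cs.IsReduced (ν.concat i) := by
    rw [IsReduced, hprod, length_concat, ← hν.eq, ← hνω]
    exact (cs.isRightDescent_iff.mp h).symm
  have hcount := cs.count_rightInvSeq_eq_of_wordProd_eq hprod (cs.simple i)
  rw [count_eq_one_of_mem hred.nodup_rightInvSeq (by rw [rightInvSeq_concat]; simp)] at hcount
  by_contra hmem
  rw [count_eq_zero_of_not_mem hmem] at hcount
  exact absurd hcount (by decide)

/-- The exchange property. -/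
theorem exists_simple_mul_wordProd_eq_eraseIdx {ω : List B} {i : B}
    (h : cs.IsLeftDescent (cs.wordProd ω) i) :
    ∃ j < ω.length, cs.simple i * cs.wordProd ω = cs.wordProd (ω.eraseIdx j) := by
  have hmem : cs.simple i ∈ cs.leftInvSeq ω := by
    rw [← isRightDescent_inv_iff, ← wordProd_reverse] at h
    have := cs.simple_mem_rightInvSeq_of_isRightDescent h
    rwa [rightInvSeq_reverse, mem_reverse] at this
  obtain ⟨j, hj, hji⟩ := mem_iff_getElem.mp hmem
  refine ⟨j, by simpa using hj, ?_⟩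
  rw [← getD_leftInvSeq_mul_wordProd, getD_eq_getElem _ _ hj, hji]

end CoxeterSystem

end Exchange

section AltWord

variable {B : Type*}

@[simp]
theorem length_altWord (s t : B) (k : ℕ) : (altWord s t k).length = k := by
  induction k generalizing s t with
  | zero => rfl
  | succ k ih => simp [altWord, ih]

theorem eraseIdx_altWord_last (s t : B) (k : ℕ) :
    (altWord s t (k + 1)).eraseIdx k = altWord s t k := by
  induction k generalizing s t with
  | zero => rfl
  | succ k ih => rw [altWord, List.eraseIdx_cons_succ, ih, altWord]

theorem exists_cons_eraseIdx_altWord_eq (s t : B) {j k : ℕ} (h : j + 1 < k) :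
    ∃ u x v, t :: (altWord s t k).eraseIdx j = u ++ x :: x :: v := by
  induction j generalizing s t k with
  | zero =>
    obtain ⟨k, rfl⟩ : ∃ n, k = n + 1 + 1 := ⟨k - 2, by lia⟩
    exact ⟨[], t, altWord s t k, by simp [altWord]⟩
  | succ j ih =>
    obtain ⟨k, rfl⟩ : ∃ n, k = n + 1 := ⟨k - 1, by lia⟩
    obtain ⟨u, x, v, huv⟩ := ih t s (k := k) (by lia)
    exact ⟨t :: u, x, v, by rw [altWord, List.eraseIdx_cons_succ, huv, List.cons_append]⟩

namespace CoxeterSystem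

variable {W : Type*} [Group W] {M : CoxeterMatrix B} (cs : CoxeterSystem M W)

theorem wordProd_altWord_mul_inv (s t : B) (k : ℕ) :
    cs.wordProd (altWord s t k) * (cs.wordProd (altWord t s k))⁻¹ =
      (cs.simple s * cs.simple t) ^ k := by
  induction k generalizing s t with
  | zero => simp [altWord]
  | succ k ih =>
    have hpow : cs.simple s * (cs.simple t * cs.simple s) ^ k =
        (cs.simple s * cs.simple t) ^ k * cs.simple s :=
      (SemiconjBy.pow_right (by simp [SemiconjBy, mul_assoc]) k : SemiconjBy (cs.simple s) _ _)
    rw [altWord, altWord, wordProd_cons, wordProd_cons, mul_inv_rev, inv_simple, mul_assoc,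
      ← mul_assoc (cs.wordProd _), ih, ← mul_assoc, hpow, pow_succ, mul_assoc]

theorem wordProd_altWord_eq_iff (s t : B) (k : ℕ) :
    cs.wordProd (altWord s t k) = cs.wordProd (altWord t s k) ↔
      (cs.simple s * cs.simple t) ^ k = 1 := by
  rw [← wordProd_altWord_mul_inv, mul_inv_eq_one]

theorem not_isReduced_append_cons_cons (u v : List B) (x : B) :
    ¬ cs.IsReduced (u ++ x :: x :: v) := by
  intro h
  have hprod : cs.wordProd (u ++ x :: x :: v) = cs.wordProd (u ++ v) := by
    simp [wordProd_append, wordProd_cons]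
  have hle := cs.length_wordProd_le (u ++ v)
  rw [← hprod, h.eq] at hle
  simp at hle

/-- If `t` is a left descent of a reduced word beginning with `(s, t, s, …)`, then either the
alternating initial segment is already as long as the braid relation, or it can be extended on the
left. -/
theorem exists_isReduced_altWord_succ {s t : B} (hst : s ≠ t) {k : ℕ} {r : List B}
    (hr : cs.IsReduced (altWord s t k ++ r))
    (ht : cs.IsLeftDescent (cs.wordProd (altWord s t k ++ r)) t) :
    (M s t ≠ 0 ∧ M s t ≤ k) ∨ ∃ r', cs.IsReduced (altWord t s (k + 1) ++ r') ∧
      cs.wordProd (altWord t s (k + 1) ++ r') = cs.wordProd (altWord s t k ++ r) := by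
  obtain ⟨j, hj, hprod⟩ := cs.exists_simple_mul_wordProd_eq_eraseIdx ht
  set ω := altWord s t k ++ r with hω
  have hword : cs.wordProd (t :: ω.eraseIdx j) = cs.wordProd ω := by
    rw [wordProd_cons, ← hprod, simple_mul_simple_cancel_left]
  have hred : cs.IsReduced (t :: ω.eraseIdx j) := by
    rw [IsReduced, hword, hr.eq, List.length_cons, List.length_eraseIdx_of_lt hj]
    lia
  rcases Nat.lt_or_ge j k with hjk | hjk
  · left
    rw [hω, List.eraseIdx_append_of_lt_length (by simpa using hjk)] at hred hword
    rcases Nat.lt_or_ge (j + 1) k with hjk' | hjk'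
    · obtain ⟨u, x, v, huv⟩ := exists_cons_eraseIdx_altWord_eq s t hjk'
      rw [← List.cons_append, huv, List.append_assoc, List.cons_append, List.cons_append] at hred
      exact absurd hred (cs.not_isReduced_append_cons_cons _ _ _)
    · obtain rfl : k = j + 1 := by lia
      rw [eraseIdx_altWord_last, ← List.cons_append, ← altWord, wordProd_append, wordProd_append,
        mul_left_inj, eq_comm, wordProd_altWord_eq_iff] at hword
      have hdvd := cs.dvd_of_simple_mul_simple_pow_eq_one hst hword
      exact ⟨fun h0 ↦ by simp [h0] at hdvd, Nat.le_of_dvd (by lia) hdvd⟩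
  · right
    rw [hω, List.eraseIdx_append_of_length_le (by simpa using hjk), ← List.cons_append,
      ← altWord] at hred hword
    exact ⟨_, hred, hword⟩

theorem lt_or_exists_isReduced_altWord {w : W} (k : ℕ) {s t : B} (hst : s ≠ t)
    (hs : cs.IsLeftDescent w s) (ht : cs.IsLeftDescent w t) :
    (M s t ≠ 0 ∧ M s t < k) ∨
      ∃ r, cs.IsReduced (altWord s t k ++ r) ∧ cs.wordProd (altWord s t k ++ r) = w := by
  induction k generalizing s t with
  | zero =>
    obtain ⟨r, hr, hw⟩ := cs.exists_isReduced w
    exact Or.inr ⟨r, hr, hw.symm⟩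
  | succ k ih =>
    rw [M.symmetric s t]
    rcases ih hst.symm ht hs with h | ⟨r, hr, rfl⟩
    · exact Or.inl ⟨h.1, h.2.trans k.lt_succ_self⟩
    · exact (cs.exists_isReduced_altWord_succ hst.symm hr hs).imp_left
        fun h ↦ ⟨h.1, Nat.lt_succ_of_le h.2⟩

/-- An element with two distinct left descents `s` and `t` has a reduced word beginning with the
braid word in `s` and `t`. -/
theorem exists_isReduced_braid_append {w : W} {s t : B} (hst : s ≠ t)
    (hs : cs.IsLeftDescent w s) (ht : cs.IsLeftDescent w t) :
    M s t ≠ 0 ∧ ∃ r, cs.IsReduced (altWord s t (M s t) ++ r) ∧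
      cs.wordProd (altWord s t (M s t) ++ r) = w := by
  refine ⟨?_, (cs.lt_or_exists_isReduced_altWord (M s t) hst hs ht).resolve_left (by simp)⟩
  rcases cs.lt_or_exists_isReduced_altWord (cs.length w + 1) hst hs ht with h | ⟨r, hr, hw⟩
  · exact h.1
  · have := hr.eq
    rw [hw] at this
    simp at this
    lia

theorem IsReduced.isLeftDescent_cons {cs : CoxeterSystem M W} {s : B} {l : List B}
    (h : cs.IsReduced (s :: l)) : cs.IsLeftDescent (cs.wordProd (s :: l)) s := by
  rw [IsLeftDescent, h.eq, wordProd_cons, simple_mul_simple_cancel_left]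
  exact Nat.lt_succ_of_le (cs.length_wordProd_le l)

/-- The word `l` is the unique reduced word of its product. -/
def IsUniqueReduced (l : List B) : Prop :=
  cs.IsReduced l ∧ ∀ l' : List B, cs.IsReduced l' → cs.wordProd l' = cs.wordProd l → l' = l

theorem IsReduced.isChain_ne {cs : CoxeterSystem M W} {l : List B} (h : cs.IsReduced l) :
    l.IsChain (· ≠ ·) := by
  rw [List.isChain_iff_getElem]
  intro i hi heq
  have hl : l = l.take i ++ l[i] :: l[i] :: l.drop (i + 1 + 1) := by
    conv_lhs => rw [← List.take_append_drop i l, List.drop_eq_getElem_cons (by lia),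
      List.drop_eq_getElem_cons hi, ← heq]
  rw [hl] at h
  exact cs.not_isReduced_append_cons_cons _ _ _ h

theorem IsUniqueReduced.not_infix_altWord {cs : CoxeterSystem M W} {l : List B}
    (h : cs.IsUniqueReduced l) {s t : B} (hst : s ≠ t) (hm : M s t ≠ 0) :
    ¬ altWord s t (M s t) <:+: l := by
  rintro ⟨u, v, rfl⟩
  have hprod : cs.wordProd (u ++ altWord t s (M s t) ++ v) =
      cs.wordProd (u ++ altWord s t (M s t) ++ v) := by
    simp only [wordProd_append,
      (cs.wordProd_altWord_eq_iff s t (M s t)).mpr (cs.simple_mul_simple_pow s t)]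
  have heq := h.2 _ (by rw [IsReduced, hprod, h.1.eq]; simp) hprod
  obtain ⟨k, hk⟩ := Nat.exists_eq_succ_of_ne_zero hm
  simp only [List.append_cancel_right_eq, List.append_cancel_left_eq, hk, altWord] at heq
  exact hst (List.cons.inj heq).1.symm

theorem isUniqueReduced_of_isChain_of_not_infix_altWord {l : List B} (hchain : l.IsChain (· ≠ ·))
    (hbraid : ∀ s t : B, s ≠ t → M s t ≠ 0 → ¬ altWord s t (M s t) <:+: l) :
    cs.IsUniqueReduced l := by
  induction l with
  | nil =>
    refine ⟨by simp [IsReduced], fun l' hl' h ↦ ?_⟩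
    have := hl'.eq
    rw [h] at this
    simpa [eq_comm] using this
  | cons s l ih =>
    obtain ⟨hred, huniq⟩ := ih hchain.tail fun s t hst hm h ↦
      hbraid s t hst hm (List.infix_cons h)
    have hcons : cs.IsReduced (s :: l) := by
      rcases cs.length_simple_mul (cs.wordProd l) s with h | h
      · rw [IsReduced, wordProd_cons, h, hred.eq, List.length_cons]
      · obtain ⟨ν, hν, hνl⟩ := cs.exists_isReduced (cs.simple s * cs.wordProd l)
        have hprod : cs.wordProd (s :: ν) = cs.wordProd l := by
          rw [wordProd_cons, ← hνl, simple_mul_simple_cancel_left]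
        have hl := huniq (s :: ν)
          (by rw [IsReduced, hprod, ← h, hνl, hν.eq, List.length_cons]) hprod
        rw [← hl] at hchain
        simp at hchain
    refine ⟨hcons, fun l' hl' hprod ↦ ?_⟩
    have htail (r : List B) (hr : cs.IsReduced (s :: r))
        (h : cs.wordProd (s :: r) = cs.wordProd (s :: l)) : r = l :=
      huniq r (by simpa using hr.drop 1) (by simpa [wordProd_cons] using h)
    match l' with
    | [] =>
      have := hl'.eq
      rw [hprod, hcons.eq] at this
      simp at this
    | t :: r =>
      rcases eq_or_ne s t with rfl | hst
      · rw [htail r hl' hprod]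
      · obtain ⟨hm, r', hr', hprod'⟩ := cs.exists_isReduced_braid_append hst
          hcons.isLeftDescent_cons (hprod ▸ hl'.isLeftDescent_cons)
        refine absurd ⟨[], r', ?_⟩ (hbraid s t hst hm)
        obtain ⟨k, hk⟩ := Nat.exists_eq_succ_of_ne_zero hm
        rw [hk, altWord, List.cons_append] at hr' hprod'
        rw [hk, altWord, List.nil_append, List.cons_append, htail _ hr' hprod']

end CoxeterSystem

end AltWord

/-- A word `l` is the unique reduced expression of its product if and only if
(1) consecutive letters of `l` are distinct, and (2) for every pair of distinct
generators `s, t` with `m(s,t)` finite (i.e. `M s t ≠ 0`), the word `l` contains no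
contiguous subword equal to the alternating word `(s,t,s,t,…)` of length `m(s,t)`. -/
theorem uniqueReducedWord_iff_no_braid_infix
    {B W : Type*} [Group W] {M : CoxeterMatrix B} (cs : CoxeterSystem M W)
    (l : List B) :
    (cs.IsReduced l ∧
        ∀ l' : List B, cs.IsReduced l' → cs.wordProd l' = cs.wordProd l → l' = l) ↔
      ((∀ i : ℕ, (h : i + 1 < l.length) →
          l.get ⟨i, Nat.lt_of_succ_lt h⟩ ≠ l.get ⟨i + 1, h⟩) ∧
        ∀ s t : B, s ≠ t → M s t ≠ 0 → ¬ (altWord s t (M s t)) <:+: l) := by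
  rw [← CoxeterSystem.IsUniqueReduced]
  have hchain : (∀ i : ℕ, (h : i + 1 < l.length) →
      l.get ⟨i, Nat.lt_of_succ_lt h⟩ ≠ l.get ⟨i + 1, h⟩) ↔ l.IsChain (· ≠ ·) := by
    simp [List.isChain_iff_getElem]
  rw [hchain]
  exact ⟨fun h ↦ ⟨h.1.isChain_ne, fun _ _ hst hm ↦ h.not_infix_altWord hst hm⟩,
    fun h ↦ cs.isUniqueReduced_of_isChain_of_not_infix_altWord h.1 h.2⟩
end

section
/- Let (W,{r,s,t}) be the Coxeter system of type W₂₃₇, with m(r,s) = 3, m(s,t) = 7 and m(r,t) = 2. Then exactly 27 non-identity elements of W have a unique reduced expression; equivalently, counting the identity (whose unique reduced expression is the empty word), the set of elements of W with a unique reduced expression has exactly 28 elements. -/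
/-- The element `w` has exactly one reduced expression with respect to the
Coxeter system `cs`. -/
def HasUniqueReducedWord {B W : Type*} [Group W] {M : CoxeterMatrix B}
    (cs : CoxeterSystem M W) (w : W) : Prop :=
  ∃! l : List B, cs.IsReduced l ∧ cs.wordProd l = w

namespace W237

variable {W : Type*} [Group W] {M : CoxeterMatrix (Fin 3)}

/-- A word is uniquely shortest if no other word of at most its length has the same product. -/
def IsUniquelyShortest {B W : Type*} [Group W] {M : CoxeterMatrix B}
    (cs : CoxeterSystem M W) (l : List B) : Prop :=
  ∀ l' : List B, l'.length ≤ l.length → cs.wordProd l' = cs.wordProd l → l' = l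

theorem hasUniqueReducedWord_iff {B W : Type*} [Group W] {M : CoxeterMatrix B}
    (cs : CoxeterSystem M W) (w : W) :
    HasUniqueReducedWord cs w ↔ ∃ l, IsUniquelyShortest cs l ∧ cs.wordProd l = w := by
  constructor
  · rintro ⟨l, ⟨hl, rfl⟩, huniq⟩
    refine ⟨l, fun l' hlen hprod => huniq l' ⟨?_, hprod⟩, rfl⟩
    have := cs.length_wordProd_le l'
    unfold CoxeterSystem.IsReduced at *
    rw [hprod] at this ⊢
    omega
  · rintro ⟨l, hl, rfl⟩
    have eq_of_isReduced : ∀ l', cs.IsReduced l' → cs.wordProd l' = cs.wordProd l → l' = l := by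
      intro l' hred hprod
      refine hl l' ?_ hprod
      rw [← hred.eq, hprod]
      exact cs.length_wordProd_le l
    obtain ⟨l', hred, hprod⟩ := cs.exists_isReduced (cs.wordProd l)
    obtain rfl := eq_of_isReduced l' hred hprod.symm
    exact ⟨l', ⟨hred, rfl⟩, fun k hk => eq_of_isReduced k hk.1 hk.2⟩

theorem IsUniquelyShortest.of_cons {B W : Type*} [Group W] {M : CoxeterMatrix B}
    {cs : CoxeterSystem M W} {i : B} {l : List B} (h : IsUniquelyShortest cs (i :: l)) :
    IsUniquelyShortest cs l := fun l' hlen hprod =>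
  List.tail_eq_of_cons_eq (h (i :: l') (by simpa using hlen) (by simp [cs.wordProd_cons, hprod]))

theorem IsUniquelyShortest.of_append_right {B W : Type*} [Group W] {M : CoxeterMatrix B}
    {cs : CoxeterSystem M W} {k l : List B} (h : IsUniquelyShortest cs (k ++ l)) :
    IsUniquelyShortest cs k := fun k' hlen hprod =>
  List.append_cancel_right
    (h (k' ++ l) (by simpa using hlen) (by simp [cs.wordProd_append, hprod]))

/-- The words with no factor among the first components of `relations`. -/
def braidFreeWords : List (List (Fin 3)) :=
  [[], [0], [1], [2], [0, 1], [1, 0], [1, 2], [2, 1], [0, 1, 2], [1, 2, 1], [2, 1, 0], [2, 1, 2],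
    [0, 1, 2, 1], [1, 2, 1, 0], [1, 2, 1, 2], [2, 1, 2, 1], [0, 1, 2, 1, 0], [0, 1, 2, 1, 2],
    [1, 2, 1, 2, 1], [2, 1, 2, 1, 0], [2, 1, 2, 1, 2], [0, 1, 2, 1, 2, 1], [1, 2, 1, 2, 1, 0],
    [1, 2, 1, 2, 1, 2], [2, 1, 2, 1, 2, 1], [0, 1, 2, 1, 2, 1, 0], [0, 1, 2, 1, 2, 1, 2],
    [2, 1, 2, 1, 2, 1, 0]]

/-- The square and braid relations of `W₂₃₇`, oriented both ways. -/
def relations : List (List (Fin 3) × List (Fin 3)) :=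
  [([0, 0], []), ([1, 1], []), ([2, 2], []), ([0, 2], [2, 0]), ([2, 0], [0, 2]),
    ([0, 1, 0], [1, 0, 1]), ([1, 0, 1], [0, 1, 0]),
    ([1, 2, 1, 2, 1, 2, 1], [2, 1, 2, 1, 2, 1, 2]), ([2, 1, 2, 1, 2, 1, 2], [1, 2, 1, 2, 1, 2, 1])]

theorem wordProd_eq_of_mem_relations (h01 : M 0 1 = 3) (h12 : M 1 2 = 7) (h02 : M 0 2 = 2)
    (cs : CoxeterSystem M W) : ∀ p ∈ relations, cs.wordProd p.1 = cs.wordProd p.2 := by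
  have braid01 := cs.wordProd_braidWord_eq 0 1
  have braid12 := cs.wordProd_braidWord_eq 1 2
  have braid02 := cs.wordProd_braidWord_eq 0 2
  simp only [CoxeterSystem.braidWord, M.symmetric 1 0, M.symmetric 2 1, M.symmetric 2 0, h01, h12,
    h02, CoxeterSystem.alternatingWord, List.concat_eq_append, List.nil_append,
    List.cons_append] at braid01 braid12 braid02
  simp only [relations, List.forall_mem_cons, List.not_mem_nil, false_implies, implies_true,
    and_true]
  refine ⟨?_, ?_, ?_, braid02, braid02.symm, braid01.symm, braid01, braid12.symm, braid12⟩ <;>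
    simp [cs.wordProd_cons]

theorem not_isUniquelyShortest_of_mem_relations (h01 : M 0 1 = 3) (h12 : M 1 2 = 7)
    (h02 : M 0 2 = 2) (cs : CoxeterSystem M W) {p : List (Fin 3) × List (Fin 3)}
    (hp : p ∈ relations) : ¬ IsUniquelyShortest cs p.1 := by
  have hlen : ∀ p ∈ relations, p.2.length ≤ p.1.length ∧ p.2 ≠ p.1 := by decide
  exact fun h => (hlen p hp).2
    (h p.2 (hlen p hp).1 (wordProd_eq_of_mem_relations h01 h12 h02 cs p hp).symm)

theorem IsUniquelyShortest.mem_braidFreeWords (h01 : M 0 1 = 3) (h12 : M 1 2 = 7)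
    (h02 : M 0 2 = 2) {cs : CoxeterSystem M W} {l : List (Fin 3)}
    (hl : IsUniquelyShortest cs l) : l ∈ braidFreeWords := by
  induction l with
  | nil => decide
  | cons i l ih =>
    have step : ∀ l ∈ braidFreeWords, ∀ i : Fin 3,
        i :: l ∈ braidFreeWords ∨ ∃ p ∈ relations, p.1 <+: i :: l := by decide +kernel
    obtain h | ⟨p, hp, k, hk⟩ := step l (ih hl.of_cons) i
    · exact h
    · rw [← hk] at hl
      exact absurd hl.of_append_right (not_isUniquelyShortest_of_mem_relations h01 h12 h02 cs hp)

/-- Three involutions generating `PGL(2, 7)` in its action on the projective line, which satisfy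
the relations of `W₂₃₇`. -/
def permGen : Fin 3 → Equiv.Perm (Fin 8) :=
  ![⟨![0, 5, 7, 6, 4, 1, 3, 2], ![0, 5, 7, 6, 4, 1, 3, 2], by decide, by decide⟩,
    ⟨![1, 0, 7, 4, 3, 5, 6, 2], ![1, 0, 7, 4, 3, 5, 6, 2], by decide, by decide⟩,
    ⟨![4, 1, 6, 7, 0, 5, 2, 3], ![4, 1, 6, 7, 0, 5, 2, 3], by decide, by decide⟩]

theorem isLiftable_permGen (h01 : M 0 1 = 3) (h12 : M 1 2 = 7) (h02 : M 0 2 = 2) :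
    M.IsLiftable permGen := by
  intro i j
  fin_cases i <;> fin_cases j <;>
    simp only [Fin.zero_eta, Fin.mk_one, Fin.reduceFinMk, M.diagonal, M.symmetric 1 0,
      M.symmetric 2 1, M.symmetric 2 0, h01, h12, h02] <;> decide +kernel

theorem prod_map_permGen_eq (h01 : M 0 1 = 3) (h12 : M 1 2 = 7) (h02 : M 0 2 = 2)
    (cs : CoxeterSystem M W) {l l' : List (Fin 3)} (h : cs.wordProd l = cs.wordProd l') :
    (l.map permGen).prod = (l'.map permGen).prod := by
  have lift_wordProd : ∀ k, cs.lift ⟨permGen, isLiftable_permGen h01 h12 h02⟩ (cs.wordProd k) =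
      (k.map permGen).prod := by
    intro k
    simp [CoxeterSystem.wordProd, map_list_prod, Function.comp_def]
  rw [← lift_wordProd, h, lift_wordProd]

/-- All words of length at most `n`. -/
def wordsUpTo : ℕ → List (List (Fin 3))
  | 0 => [[]]
  | n + 1 => [] :: (wordsUpTo n).flatMap fun l => [0 :: l, 1 :: l, 2 :: l]

theorem mem_wordsUpTo {n : ℕ} {l : List (Fin 3)} (h : l.length ≤ n) : l ∈ wordsUpTo n := by
  induction n generalizing l with
  | zero => simp_all [wordsUpTo]
  | succ n ih =>
    cases l with
    | nil => simp [wordsUpTo]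
    | cons i l =>
      simp only [wordsUpTo, List.mem_cons, List.mem_flatMap, reduceCtorEq, false_or]
      refine ⟨l, ih (by simpa using h), ?_⟩
      fin_cases i <;> simp

theorem eq_of_prod_map_permGen_eq : ∀ l ∈ braidFreeWords, ∀ l' ∈ wordsUpTo l.length,
    (l'.map permGen).prod = (l.map permGen).prod → l' = l := by
  decide +kernel

theorem isUniquelyShortest_iff (h01 : M 0 1 = 3) (h12 : M 1 2 = 7) (h02 : M 0 2 = 2)
    (cs : CoxeterSystem M W) (l : List (Fin 3)) :
    IsUniquelyShortest cs l ↔ l ∈ braidFreeWords :=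
  ⟨fun h => h.mem_braidFreeWords h01 h12 h02, fun h l' hlen hprod =>
    eq_of_prod_map_permGen_eq l h l' (mem_wordsUpTo hlen)
      (prod_map_permGen_eq h01 h12 h02 cs hprod)⟩

theorem ncard_image_wordProd {cs : CoxeterSystem M W} {L : List (List (Fin 3))}
    (hL : ∀ l ∈ L, IsUniquelyShortest cs l) (hnodup : L.Nodup) :
    (cs.wordProd '' {l | l ∈ L}).ncard = L.length := by
  rw [Set.InjOn.ncard_image, ← List.coe_toFinset, Set.ncard_coe_finset,
    List.toFinset_card_of_nodup hnodup]
  intro l hl l' hl' h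
  rcases le_total l.length l'.length with hlen | hlen
  · exact hL l' hl' l hlen h
  · exact (hL l hl l' hlen h.symm).symm

end W237

/-- In the Coxeter system of type `W₂₃₇`, with generators `r = 0`, `s = 1`, `t = 2`
and `m(r,s) = 3`, `m(s,t) = 7`, `m(r,t) = 2`, exactly `27` non-identity elements
have a unique reduced expression; including the identity (whose unique reduced
expression is the empty word), exactly `28` elements have a unique reduced
expression. -/
theorem W237_count_uniqueReducedWord
    {W : Type*} [Group W] {M : CoxeterMatrix (Fin 3)}
    (h01 : M 0 1 = 3) (h12 : M 1 2 = 7) (h02 : M 0 2 = 2)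
    (cs : CoxeterSystem M W) :
    {w : W | HasUniqueReducedWord cs w ∧ w ≠ 1}.ncard = 27 ∧
      {w : W | HasUniqueReducedWord cs w}.ncard = 28 := by
  have hset : {w : W | HasUniqueReducedWord cs w} =
      cs.wordProd '' {l | l ∈ W237.braidFreeWords} := by
    ext w
    simp [W237.hasUniqueReducedWord_iff, W237.isUniquelyShortest_iff h01 h12 h02]
  have hcard : {w : W | HasUniqueReducedWord cs w}.ncard = 28 := by
    rw [hset, W237.ncard_image_wordProd
      (fun l hl => (W237.isUniquelyShortest_iff h01 h12 h02 cs l).2 hl) (by decide)]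
    rfl
  refine ⟨?_, hcard⟩
  have hone : (1 : W) ∈ {w : W | HasUniqueReducedWord cs w} := by
    rw [hset]
    exact ⟨[], by simp [W237.braidFreeWords], cs.wordProd_nil⟩
  have hdiff : {w : W | HasUniqueReducedWord cs w ∧ w ≠ 1} =
      {w : W | HasUniqueReducedWord cs w} \ {1} := rfl
  rw [hdiff, Set.ncard_sdiff_singleton_of_mem hone, hcard]
end
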